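/- arXiv:2508.19206 — 7 statements merged into one kernel-verified Lean document; each statement's English description precedes it below -/
import Mathlib

section
/- Let p be a polynomial over ℝ of degree r ≥ 2 with leading coefficient a, and let n, m be integers. Then applying to p first the symmetric discrete derivative Δ̃_m and then the symmetric discrete derivative Δ̃_1 a total of r − 2 times, and evaluating the resulting polynomial at n, yields r! · a · n · m. -/
open Polynomial

/-- The symmetric discrete derivative `Δ̃_m p = p(X + m) - p(X) - (p(m) - p(0))`. -/
noncomputable def symDiscDeriv (m : ℝ) (p : Polynomial ℝ) : Polynomial ℝ :=
  p.comp (X + C m) - p - C (p.eval m - p.eval 0)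

theorem eval_zero_symDiscDeriv (m : ℝ) (p : Polynomial ℝ) : (symDiscDeriv m p).eval 0 = 0 := by
  simp [symDiscDeriv]

theorem coeff_succ_symDiscDeriv (m : ℝ) (p : Polynomial ℝ) (k : ℕ) :
    (symDiscDeriv m p).coeff (k + 1) =
      (hasseDeriv (k + 1) p).eval m - p.coeff (k + 1) := by
  simp only [symDiscDeriv, ← taylor_apply, coeff_sub, taylor_coeff, coeff_C_succ, sub_zero]

theorem natDegree_symDiscDeriv_le (m : ℝ) {p : Polynomial ℝ} {k : ℕ}
    (hp : p.natDegree ≤ k + 1) : (symDiscDeriv m p).natDegree ≤ k := by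
  rw [natDegree_le_iff_coeff_eq_zero]
  intro N hN
  obtain ⟨j, rfl⟩ : ∃ j, N = j + 1 := ⟨N - 1, by omega⟩
  have hd : (hasseDeriv (j + 1) p).natDegree < 1 := by
    have := natDegree_hasseDeriv_le p (j + 1)
    omega
  rw [coeff_succ_symDiscDeriv, eval_eq_sum_range' hd]
  simp [hasseDeriv_coeff]

theorem coeff_symDiscDeriv_of_natDegree_le (m : ℝ) {p : Polynomial ℝ} {k : ℕ}
    (hp : p.natDegree ≤ k + 2) :
    (symDiscDeriv m p).coeff (k + 1) = (k + 2) * m * p.coeff (k + 2) := by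
  have hd : (hasseDeriv (k + 1) p).natDegree < 2 := by
    have := natDegree_hasseDeriv_le p (k + 1)
    omega
  have hc : (k + 2).choose (k + 1) = k + 2 := Nat.choose_succ_self_right (k + 1)
  rw [coeff_succ_symDiscDeriv, eval_eq_sum_range' hd]
  simp only [Finset.sum_range_succ, Finset.sum_range_zero, hasseDeriv_coeff, zero_add,
    Nat.choose_self, pow_zero, pow_one, show 1 + (k + 1) = k + 2 by omega, hc]
  push_cast
  ring

theorem eval_iterate_symDiscDeriv_one (k : ℕ) {p : Polynomial ℝ} (hp : p.natDegree ≤ k + 1)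
    (h0 : p.eval 0 = 0) (x : ℝ) :
    ((symDiscDeriv 1)^[k] p).eval x = ((k + 1).factorial : ℝ) * p.coeff (k + 1) * x := by
  induction k generalizing p with
  | zero =>
    rw [← coeff_zero_eq_eval_zero] at h0
    rw [Function.iterate_zero_apply, eval_eq_sum_range' (Nat.lt_succ_of_le hp)]
    simp [Finset.sum_range_succ, h0]
  | succ k ih =>
    rw [Function.iterate_succ_apply, ih (natDegree_symDiscDeriv_le 1 hp)
      (eval_zero_symDiscDeriv 1 p), coeff_symDiscDeriv_of_natDegree_le 1 hp,
      Nat.factorial_succ (k + 1)]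
    push_cast
    ring

/-- for a polynomial `p` of degree `r ≥ 2` with leading coefficient `a`
and integers `n, m`, applying to `p` first `Δ̃_m` and then `Δ̃_1` a total of `r - 2`
times, and evaluating at `n`, yields `r! · a · n · m`. -/
theorem symDiscDeriv_iterate_eval (p : Polynomial ℝ) (r : ℕ) (a : ℝ) (hr : 2 ≤ r)
    (hdeg : p.degree = r) (hlead : p.leadingCoeff = a) (n m : ℤ) :
    ((symDiscDeriv 1)^[r - 2] (symDiscDeriv (m : ℝ) p)).eval (n : ℝ) =
      (r.factorial : ℝ) * a * n * m := by
  obtain ⟨k, rfl⟩ : ∃ k, r = k + 2 := ⟨r - 2, by omega⟩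
  have hnat : p.natDegree = k + 2 := natDegree_eq_of_degree_eq_some hdeg
  have hcoeff : p.coeff (k + 2) = a := by rw [← hlead, leadingCoeff, hnat]
  rw [Nat.add_sub_cancel, eval_iterate_symDiscDeriv_one k (natDegree_symDiscDeriv_le _ hnat.le)
    (eval_zero_symDiscDeriv _ p), coeff_symDiscDeriv_of_natDegree_le _ hnat.le, hcoeff,
    Nat.factorial_succ (k + 1)]
  push_cast
  ring
end

section
/- Let p be a polynomial over ℝ of degree r ≥ 1 with leading coefficient a, and let m₁, …, m_r be integers. Then the polynomial obtained from p by successively applying the discrete derivatives Δ_{m₁}, …, Δ_{m_r} is the constant polynomial r! · a · m₁ · m₂ ⋯ m_r. -/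
open Polynomial

/-- The discrete derivative `Δ_m p = p(X + m) - p(X)` of a polynomial. -/
noncomputable def discDeriv (m : ℝ) (p : Polynomial ℝ) : Polynomial ℝ :=
  p.comp (X + C m) - p

theorem discDeriv_coeff (m : ℝ) (p : Polynomial ℝ) (k : ℕ) :
    (discDeriv m p).coeff k = (hasseDeriv k p).eval m - p.coeff k := by
  rw [discDeriv, ← taylor_apply, coeff_sub, taylor_coeff]

theorem natDegree_discDeriv_le {p : Polynomial ℝ} {n : ℕ} (m : ℝ) (hp : p.natDegree ≤ n + 1) :
    (discDeriv m p).natDegree ≤ n := by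
  rw [natDegree_le_iff_coeff_eq_zero]
  intro k hk
  have hd : (hasseDeriv k p).natDegree < 1 := by
    have := natDegree_hasseDeriv_le p k
    omega
  rw [discDeriv_coeff, eval_eq_sum_range' hd]
  simp [hasseDeriv_coeff]

theorem discDeriv_coeff_of_natDegree_le {p : Polynomial ℝ} {n : ℕ} (m : ℝ)
    (hp : p.natDegree ≤ n + 1) :
    (discDeriv m p).coeff n = (n + 1) * m * p.coeff (n + 1) := by
  have hd : (hasseDeriv n p).natDegree < 2 := by
    have := natDegree_hasseDeriv_le p n
    omega
  rw [discDeriv_coeff, eval_eq_sum_range' hd]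
  simp [hasseDeriv_coeff, Finset.sum_range_succ, add_comm 1 n]
  ring

theorem foldr_discDeriv_natDegree_le_and_coeff (p : Polynomial ℝ) (ms : List ℝ) (n : ℕ)
    (hp : p.natDegree ≤ n + ms.length) :
    (ms.foldr discDeriv p).natDegree ≤ n ∧
      (n.factorial : ℝ) * (ms.foldr discDeriv p).coeff n =
        ((n + ms.length).factorial : ℝ) * p.coeff (n + ms.length) * ms.prod := by
  induction ms generalizing n with
  | nil => simpa using hp
  | cons m ms ih =>
    have hn : n + (m :: ms).length = n + 1 + ms.length := by
      rw [List.length_cons]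
      omega
    rw [hn] at hp ⊢
    obtain ⟨hdeg, hcoeff⟩ := ih (n + 1) hp
    rw [List.foldr_cons]
    refine ⟨natDegree_discDeriv_le _ hdeg, ?_⟩
    rw [discDeriv_coeff_of_natDegree_le _ hdeg, List.prod_cons]
    rw [Nat.factorial_succ, Nat.cast_mul, Nat.cast_succ] at hcoeff
    linear_combination m * hcoeff

/-- for a polynomial `p` of degree `r ≥ 1` with leading coefficient `a`
and integers `m₁, …, m_r`, successively applying the discrete derivatives
`Δ_{m₁}, …, Δ_{m_r}` to `p` yields the constant polynomial `r! · a · m₁ ⋯ m_r`. -/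
theorem discDeriv_iterate_const (p : Polynomial ℝ) (r : ℕ) (a : ℝ) (hr : 1 ≤ r)
    (hdeg : p.degree = r) (hlead : p.leadingCoeff = a)
    (ms : List ℤ) (hlen : ms.length = r) :
    ms.foldr (fun mi q => discDeriv (mi : ℝ) q) p =
      C ((r.factorial : ℝ) * a * ((ms.prod : ℤ) : ℝ)) := by
  have hnat : p.natDegree = r := natDegree_eq_of_degree_eq_some hdeg
  have hcast : (do let m ← ms; pure (m : ℝ)) = ms.map (Int.cast : ℤ → ℝ) := by
    simp [List.map_eq_flatMap]
  rw [hcast]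
  obtain ⟨h0, hcoeff⟩ :=
    foldr_discDeriv_natDegree_le_and_coeff p (ms.map (Int.cast : ℤ → ℝ)) 0 (by simp; omega)
  rw [eq_C_of_natDegree_le_zero h0]
  rw [Nat.factorial_zero, Nat.cast_one, one_mul, zero_add, List.length_map, hlen] at hcoeff
  rw [hcoeff, ← hlead, leadingCoeff, hnat, Int.cast_list_prod]
end

section
/- Let d ≥ 1 be a natural number, x₀ a real number, and f : ℝ → ℝ a function that is d times continuously differentiable on [x₀, ∞), such that the function x ↦ |f^{(d)}(x)| is antitone (nonincreasing) on [x₀, ∞) and f^{(d)}(x) → 0 as x → ∞. Then for every natural number M and every ε > 0 there exist a natural number N with N ≥ x₀ and a polynomial p over ℝ of degree at most d − 1 such that |f(N + m) − p(m)| < ε for all natural numbers m < M. -/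
open Set Filter

open Polynomial in
/-- The Taylor polynomial of order `n` at `a`, as a polynomial in the increment. -/
theorem exists_polynomial_eval_eq_taylorWithinEval (f : ℝ → ℝ) (n : ℕ) (s : Set ℝ) (a : ℝ) :
    ∃ p : ℝ[X], p.degree ≤ (n : WithBot ℕ) ∧
      ∀ h : ℝ, p.eval h = taylorWithinEval f n s a (a + h) := by
  refine ⟨∑ k ∈ Finset.range (n + 1),
    C ((k.factorial : ℝ)⁻¹ * iteratedDerivWithin k f s a) * X ^ k, ?_, fun h => ?_⟩
  · refine (degree_sum_le _ _).trans (Finset.sup_le fun k hk => ?_)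
    refine (degree_C_mul_X_pow_le k _).trans ?_
    exact_mod_cast Nat.lt_succ_iff.mp (Finset.mem_range.mp hk)
  · rw [taylor_within_apply, eval_finsetSum]
    refine Finset.sum_congr rfl fun k _ => ?_
    simp only [eval_mul, eval_C, eval_pow, eval_X, add_sub_cancel_left, smul_eq_mul]
    ring

/-- Away from the left endpoint, the iterated derivative within a half-line agrees with the one
within a compact subinterval. -/
theorem iteratedDerivWithin_Icc_eq_iteratedDerivWithin_Ici {f : ℝ → ℝ} {n : ℕ} {x₀ a b y : ℝ}
    (hf : ContDiffOn ℝ n f (Ici x₀)) (ha : x₀ < a) (hab : a < b) (hy : y ∈ Icc a b) :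
    iteratedDerivWithin n f (Icc a b) y = iteratedDerivWithin n f (Ici x₀) y := by
  have hlt : x₀ < y := ha.trans_le hy.1
  have hat : ContDiffAt ℝ n f y := hf.contDiffAt (Ici_mem_nhds hlt)
  rw [iteratedDerivWithin_eq_iteratedDeriv (uniqueDiffOn_Icc hab) hat hy,
    iteratedDerivWithin_eq_iteratedDeriv (uniqueDiffOn_Ici x₀) hat hlt.le]

/-- the property `P_d`. If `f` is `d` times continuously differentiable
on `[x₀, ∞)`, `|f^{(d)}|` is antitone there and `f^{(d)}(x) → 0` as `x → ∞`, then for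
every `M` and `ε > 0` there are a natural number `N ≥ x₀` and a polynomial `p` of
degree at most `d - 1` with `|f(N + m) - p(m)| < ε` for all `m < M`. -/
theorem property_P_d (d : ℕ) (hd : 1 ≤ d) (x₀ : ℝ) (f : ℝ → ℝ)
    (hf : ContDiffOn ℝ d f (Ici x₀))
    (hanti : AntitoneOn (fun x => |iteratedDerivWithin d f (Ici x₀) x|) (Ici x₀))
    (hlim : Tendsto (iteratedDerivWithin d f (Ici x₀)) atTop (nhds 0)) :
    ∀ M : ℕ, ∀ ε : ℝ, 0 < ε → ∃ N : ℕ, x₀ ≤ (N : ℝ) ∧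
      ∃ p : Polynomial ℝ, p.degree ≤ ((d - 1 : ℕ) : WithBot ℕ) ∧
        ∀ m : ℕ, m < M → |f ((N : ℝ) + (m : ℝ)) - p.eval (m : ℝ)| < ε := by
  intro M ε hε
  obtain ⟨n, rfl⟩ : ∃ n, d = n + 1 := ⟨d - 1, by omega⟩
  set L : ℝ := M + 1
  have hL : 0 < L := by positivity
  set δ : ℝ := ε / (2 * L ^ (n + 1))
  have hδ : 0 < δ := by positivity
  obtain ⟨K, hK⟩ := eventually_atTop.mp (hlim.eventually (Metric.ball_mem_nhds 0 hδ))
  obtain ⟨N, hN⟩ := exists_nat_gt (max x₀ K)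
  have hNx : x₀ < N := (le_max_left _ _).trans_lt hN
  have hNK : K < N := (le_max_right _ _).trans_lt hN
  have hNL : (N : ℝ) < N + L := by linarith
  obtain ⟨p, hp, hpe⟩ :=
    exists_polynomial_eval_eq_taylorWithinEval f n (Icc (N : ℝ) (N + L)) N
  refine ⟨N, hNx.le, p, by simpa using hp, fun m hm => ?_⟩
  have hmL : (m : ℝ) ≤ L := by
    have : (m : ℝ) < M := by exact_mod_cast hm
    simp only [L]
    linarith
  have hbound : ∀ y ∈ Icc (N : ℝ) (N + L),
      ‖iteratedDerivWithin (n + 1) f (Icc (N : ℝ) (N + L)) y‖ ≤ δ := by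
    intro y hy
    rw [iteratedDerivWithin_Icc_eq_iteratedDerivWithin_Ici hf hNx hNL hy]
    exact (mem_ball_zero_iff.mp (hK y (hNK.le.trans hy.1))).le
  have hfI : ContDiffOn ℝ (n + 1) f (Icc (N : ℝ) (N + L)) := by
    have hsub : Icc (N : ℝ) (N + L) ⊆ Ici x₀ := fun y hy => hNx.le.trans hy.1
    exact_mod_cast hf.mono hsub
  have hmem : (N : ℝ) + m ∈ Icc (N : ℝ) (N + L) :=
    ⟨le_add_of_nonneg_right m.cast_nonneg, by linarith⟩
  have hfact : (1 : ℝ) ≤ n.factorial := by exact_mod_cast n.factorial_pos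
  rw [hpe, ← Real.norm_eq_abs]
  calc
    _ ≤ δ * ((N : ℝ) + m - N) ^ (n + 1) / n.factorial :=
      taylor_mean_remainder_bound hNL.le hfI hmem hbound
    _ ≤ δ * (m : ℝ) ^ (n + 1) := by
      rw [add_sub_cancel_left]
      exact div_le_self (by positivity) hfact
    _ ≤ δ * L ^ (n + 1) := by gcongr
    _ = ε / 2 := by simp only [δ]; field_simp
    _ < ε := half_lt_self hε
end

section
/- Let N be an integer, M ≥ 1 a natural number, n an integer, and f : ℝ → ℝ a twice differentiable function whose second derivative f'' is nonnegative and antitone (nonincreasing) on [N, ∞). Assume: (i) |f(N) − round(f(N))| < 1/4; (ii) |f'(N) − n| < 1/(8M); (iii) f''(N) < 1/(8M²). Then for every natural number m with m ≤ M, round(f(N + m)) = round(f(N)) + n·m. -/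
open Set

/-- if `f` is twice differentiable, `f''` is nonnegative and antitone
on `[N, ∞)`, `|f(N) - round(f(N))| < 1/4`, `|f'(N) - n| < 1/(8M)` and
`f''(N) < 1/(8M²)`, then `round(f(N + m)) = round(f(N)) + n·m` for all `m ≤ M`. -/
theorem lambda_conditions (N : ℤ) (M : ℕ) (hM : 1 ≤ M) (n : ℤ) (f : ℝ → ℝ)
    (hf : Differentiable ℝ f) (hf' : Differentiable ℝ (deriv f))
    (h2nonneg : ∀ x : ℝ, (N : ℝ) ≤ x → 0 ≤ deriv (deriv f) x)
    (h2anti : AntitoneOn (deriv (deriv f)) (Ici (N : ℝ)))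
    (h0 : |f (N : ℝ) - (round (f (N : ℝ)) : ℝ)| < 1 / 4)
    (h1 : |deriv f (N : ℝ) - (n : ℝ)| < 1 / (8 * (M : ℝ)))
    (h2 : deriv (deriv f) (N : ℝ) < 1 / (8 * (M : ℝ) ^ 2)) :
    ∀ m : ℕ, m ≤ M → round (f ((N : ℝ) + (m : ℝ))) = round (f (N : ℝ)) + n * m := by
  intro m hm
  rcases Nat.eq_zero_or_pos m with rfl | hm0
  · simp
  have hM0 : (0 : ℝ) < M := by exact_mod_cast hM
  have hm0' : (0 : ℝ) < m := by exact_mod_cast hm0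
  have hmM : (m : ℝ) ≤ M := by exact_mod_cast hm
  obtain ⟨ξ, ⟨hξ1, hξ2⟩, hξ⟩ := exists_deriv_eq_slope f
    (show (N : ℝ) < N + m by linarith) hf.continuous.continuousOn hf.differentiableOn
  obtain ⟨η, ⟨hη1, -⟩, hη⟩ := exists_deriv_eq_slope (deriv f) hξ1
    hf'.continuous.continuousOn hf'.differentiableOn
  rw [add_sub_cancel_left, eq_div_iff hm0'.ne'] at hξ
  rw [eq_div_iff (sub_pos.2 hξ1).ne'] at hη
  have hη0 : 0 ≤ deriv (deriv f) η := h2nonneg η hη1.le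
  have hηN : deriv (deriv f) η ≤ 1 / (8 * (M : ℝ) ^ 2) :=
    (h2anti self_mem_Ici hη1.le hη1.le).trans h2.le
  have hlow : 0 ≤ deriv f ξ - deriv f N := hη ▸ mul_nonneg hη0 (sub_pos.2 hξ1).le
  have hupp : deriv f ξ - deriv f N ≤ 1 / (8 * (M : ℝ)) := by
    calc deriv f ξ - deriv f N = deriv (deriv f) η * (ξ - N) := hη.symm
      _ ≤ 1 / (8 * (M : ℝ) ^ 2) * M :=
        mul_le_mul hηN (by linarith) (sub_pos.2 hξ1).le (by positivity)
      _ = 1 / (8 * (M : ℝ)) := by field_simp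
  have hslope : |deriv f ξ - n| ≤ 1 / (4 * (M : ℝ)) := by
    have h : 1 / (4 * (M : ℝ)) = 1 / (8 * (M : ℝ)) + 1 / (8 * (M : ℝ)) := by
      field_simp
      norm_num
    rw [abs_lt] at h1
    rw [abs_le]
    constructor <;> linarith
  have hincr : |(deriv f ξ - n) * m| ≤ 1 / 4 := by
    rw [abs_mul, abs_of_pos hm0']
    calc |deriv f ξ - n| * m ≤ 1 / (4 * (M : ℝ)) * M := by gcongr
      _ = 1 / 4 := by field_simp
  rw [abs_lt] at h0
  rw [abs_le] at hincr
  rw [round_eq (f (N + m)), Int.floor_eq_iff]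
  push_cast
  constructor <;> linarith
end

section
/- Let x₀ be a real number and f : ℝ → ℝ a twice differentiable function such that on [x₀, ∞): the second derivative f'' is positive and antitone (nonincreasing), f''(x) → 0 as x → ∞, and f'(x) → ∞ as x → ∞. Then for every real x₁ ≥ x₀ and all ε₀, ε₁, ε₂ > 0 there exists a natural number n₀ such that for every natural number n ≥ n₀ there exists an integer N with: (i) N ≥ x₁; (ii) |f(N) − round(f(N))| < ε₀; (iii) |f'(N) − n| < ε₁; (iv) f''(N) < ε₂. -/
open Set Filter

/-- If a real sequence has all its first `K` increments in `[a, b]`, where `0 < a` and `1 ≤ K * a`,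
then one of its first `K + 1` terms lies within `b` of an integer. -/
lemma exists_abs_sub_int_le_of_increments (g : ℕ → ℝ) (a b : ℝ) (K : ℕ) (hb : 0 ≤ b)
    (hK : 1 ≤ K * a) (hlo : ∀ j < K, a ≤ g (j + 1) - g j) (hhi : ∀ j < K, g (j + 1) - g j ≤ b) :
    ∃ j ≤ K, ∃ m : ℤ, |g j - m| ≤ b := by
  classical
  have hgrow : ∀ j ≤ K, g 0 + j * a ≤ g j := by
    intro j
    induction j with
    | zero => simp
    | succ j ih =>
      intro hj
      have h1 := ih (by omega)
      have h2 := hlo j (by omega)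
      push_cast
      linarith
  have hex : ∃ j, (⌈g 0⌉ : ℝ) ≤ g j :=
    ⟨K, by linarith [hgrow K le_rfl, Int.ceil_lt_add_one (g 0)]⟩
  have hle : Nat.find hex ≤ K :=
    Nat.find_min' hex (by linarith [hgrow K le_rfl, Int.ceil_lt_add_one (g 0)])
  refine ⟨Nat.find hex, hle, ⌈g 0⌉, ?_⟩
  have hspec := Nat.find_spec hex
  rw [abs_of_nonneg (sub_nonneg.2 hspec)]
  rcases hj : Nat.find hex with _ | j
  · linarith [Int.le_ceil (g 0)]
  · have hmin := not_le.1 (Nat.find_min hex (m := j) (by omega))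
    linarith [hhi j (by omega)]

/-- if `f` is twice differentiable, with `f''` positive and antitone on
`[x₀, ∞)`, `f''(x) → 0` and `f'(x) → ∞`, then for all `x₁ ≥ x₀` and `ε₀, ε₁, ε₂ > 0`,
for every sufficiently large natural number `n` there is an integer `N ≥ x₁` with
`|f(N) - round(f(N))| < ε₀`, `|f'(N) - n| < ε₁` and `f''(N) < ε₂`. -/
theorem lambda_sufficient (x₀ : ℝ) (f : ℝ → ℝ)
    (hf : Differentiable ℝ f) (hf' : Differentiable ℝ (deriv f))
    (h2pos : ∀ x : ℝ, x₀ ≤ x → 0 < deriv (deriv f) x)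
    (h2anti : AntitoneOn (deriv (deriv f)) (Ici x₀))
    (h2lim : Tendsto (deriv (deriv f)) atTop (nhds 0))
    (h1lim : Tendsto (deriv f) atTop atTop) :
    ∀ x₁ : ℝ, x₀ ≤ x₁ → ∀ ε₀ ε₁ ε₂ : ℝ, 0 < ε₀ → 0 < ε₁ → 0 < ε₂ →
      ∃ n₀ : ℕ, ∀ n : ℕ, n₀ ≤ n → ∃ N : ℤ,
        x₁ ≤ (N : ℝ) ∧ |f (N : ℝ) - (round (f (N : ℝ)) : ℝ)| < ε₀ ∧
        |deriv f (N : ℝ) - (n : ℝ)| < ε₁ ∧ deriv (deriv f) (N : ℝ) < ε₂ := by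
  intro x₁ hx₁ ε₀ ε₁ ε₂ hε₀ hε₁ hε₂
  obtain ⟨ε, hε, hεlt⟩ := exists_between (lt_min hε₀ hε₁)
  obtain ⟨hεε₀, hεε₁⟩ := lt_min_iff.1 hεlt
  obtain ⟨K, hK⟩ := exists_nat_ge (2 / ε)
  have hKε : 1 ≤ (K : ℝ) * (ε / 2) := by
    rw [div_le_iff₀ hε] at hK
    linarith
  obtain ⟨δ, hδ, hδlt⟩ : ∃ δ, 0 < δ ∧ δ < min ε₂ (ε / 2 / (K + 1)) :=
    exists_between (lt_min hε₂ (by positivity))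
  obtain ⟨hδε₂, hδK⟩ := lt_min_iff.1 hδlt
  rw [lt_div_iff₀ (by positivity)] at hδK
  obtain ⟨X₀, hX₀⟩ := eventually_atTop.1 (h2lim.eventually (gt_mem_nhds hδ))
  obtain ⟨X, hXX₀, hXx₁⟩ : ∃ X, X₀ ≤ X ∧ x₁ ≤ X := ⟨max X₀ x₁, le_max_left _ _, le_max_right _ _⟩
  have hlt : ∀ x, X ≤ x → deriv (deriv f) x < δ := fun x hx => hX₀ x (hXX₀.trans hx)
  have hmono : ∀ x y, X ≤ x → x ≤ y → deriv f x ≤ deriv f y := by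
    intro x y hx hxy
    rcases hxy.eq_or_lt with rfl | hxy
    · rfl
    obtain ⟨c, hc, hc'⟩ := exists_deriv_eq_slope (deriv f) hxy hf'.continuous.continuousOn
      hf'.differentiableOn
    have hpos := h2pos c (by linarith [hc.1])
    rw [hc', div_pos_iff_of_pos_right (sub_pos.2 hxy)] at hpos
    linarith
  have hlip : ∀ x y, X ≤ x → x ≤ y → deriv f y ≤ deriv f x + δ * (y - x) := by
    intro x y hx hxy
    rcases hxy.eq_or_lt with rfl | hxy
    · simp
    obtain ⟨c, hc, hc'⟩ := exists_deriv_eq_slope (deriv f) hxy hf'.continuous.continuousOn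
      hf'.differentiableOn
    have hcδ := hlt c (by linarith [hc.1])
    rw [hc', div_lt_iff₀ (sub_pos.2 hxy)] at hcδ
    linarith
  obtain ⟨n₀, hn₀⟩ := exists_nat_ge (deriv f X)
  refine ⟨n₀, fun n hn => ?_⟩
  have hnX : deriv f X ≤ n := hn₀.trans (by exact_mod_cast hn)
  obtain ⟨e, hXe, he⟩ : ∃ e, X ≤ e ∧ deriv f e = n + ε / 2 := by
    obtain ⟨Y, hY, hXY⟩ :=
      ((h1lim.eventually_ge_atTop (n + ε / 2)).and (eventually_ge_atTop X)).exists
    obtain ⟨e, he, he'⟩ := intermediate_value_Icc hXY hf'.continuous.continuousOn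
      (show (n : ℝ) + ε / 2 ∈ Icc (deriv f X) (deriv f Y) from ⟨by linarith, hY⟩)
    exact ⟨e, he.1, he'⟩
  have hwin : ∀ x, e ≤ x → x ≤ e + (K + 1) → n + ε / 2 ≤ deriv f x ∧ deriv f x ≤ n + ε := by
    intro x hx hx'
    refine ⟨he ▸ hmono e x hXe hx, ?_⟩
    have h1 := hlip e x hXe hx
    have h2 : δ * (x - e) ≤ δ * (K + 1) := by gcongr; linarith
    linarith
  have hM := Int.le_ceil e
  have hM' := Int.ceil_lt_add_one e
  have hinc : ∀ j < K, ε / 2 ≤ f (⌈e⌉ + (j + 1)) - f (⌈e⌉ + j) - n ∧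
      f (⌈e⌉ + (j + 1)) - f (⌈e⌉ + j) - n ≤ ε := by
    intro j hj
    have hjK : (j : ℝ) + 1 ≤ K := by exact_mod_cast hj
    have hj0 : (0 : ℝ) ≤ j := j.cast_nonneg
    obtain ⟨c, hc, hc'⟩ := exists_deriv_eq_slope f
      (show (⌈e⌉ + j : ℝ) < ⌈e⌉ + (j + 1) by linarith) hf.continuous.continuousOn
      hf.differentiableOn
    rw [show (⌈e⌉ + (j + 1) : ℝ) - (⌈e⌉ + j) = 1 by ring, div_one] at hc'
    obtain ⟨h1, h2⟩ := hwin c (by linarith [hc.1]) (by linarith [hc.2])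
    constructor <;> linarith
  obtain ⟨j, hj, m, hm⟩ := exists_abs_sub_int_le_of_increments
    (fun j => f (⌈e⌉ + j) - n * j) (ε / 2) ε K hε.le hKε
    (fun j hj => by push_cast; linarith [(hinc j hj).1])
    (fun j hj => by push_cast; linarith [(hinc j hj).2])
  have hjK : (j : ℝ) ≤ K := by exact_mod_cast hj
  have hj0 : (0 : ℝ) ≤ j := j.cast_nonneg
  refine ⟨⌈e⌉ + j, ?_⟩
  push_cast
  obtain ⟨h1, h2⟩ := hwin (⌈e⌉ + j) (by linarith) (by linarith)
  refine ⟨by linarith, ?_, ?_, (hlt _ (by linarith)).trans hδε₂⟩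
  · refine (round_le _ (m + n * j)).trans_lt (lt_of_le_of_lt ?_ hεε₀)
    push_cast
    rwa [add_comm (m : ℝ), ← sub_sub]
  · rw [abs_lt]
    constructor <;> linarith
end

section
/- Let x₀ be a real number and f : ℝ → ℝ a twice differentiable function such that on [x₀, ∞): the second derivative f'' is positive and antitone (nonincreasing), f''(x) → 0 as x → ∞, and f'(x) → ∞ as x → ∞. Then for every natural number M there exists a natural number n₀ such that for every natural number n ≥ n₀ there exists an integer N such that round(f(N + m)) = round(f(N)) + n·m for all natural numbers m ≤ M. -/
open Set Filter

/-- If `h' ≥ 0` and `h'' ≤ ε` on `[c, ∞)` and `h' c = 0`, then `h' ^ 2 ≤ 2 * ε * (h - h c)`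
on `[c, ∞)`. -/
lemma sq_deriv_le_two_mul {h h' h'' : ℝ → ℝ} {c ε : ℝ}
    (hh : ∀ x, HasDerivAt h (h' x) x) (hh' : ∀ x, HasDerivAt h' (h'' x) x)
    (hnonneg : ∀ x, c ≤ x → 0 ≤ h' x) (hle : ∀ x, c ≤ x → h'' x ≤ ε) (hc : h' c = 0)
    {t : ℝ} (ht : c ≤ t) : h' t ^ 2 ≤ 2 * ε * (h t - h c) := by
  have hd : ∀ x, HasDerivAt (fun y => h' y ^ 2 - 2 * ε * h y)
      (2 * h' x * (h'' x - ε)) x := fun x => by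
    refine (((hh' x).pow 2).sub ((hh x).const_mul (2 * ε))).congr_deriv ?_
    push_cast
    ring
  have hanti : AntitoneOn (fun y => h' y ^ 2 - 2 * ε * h y) (Ici c) := by
    refine antitoneOn_of_deriv_nonpos (convex_Ici c)
      (fun x _ => (hd x).continuousAt.continuousWithinAt)
      (fun x _ => (hd x).differentiableAt.differentiableWithinAt) fun x hx => ?_
    rw [interior_Ici] at hx
    rw [(hd x).deriv]
    exact mul_nonpos_of_nonneg_of_nonpos (mul_nonneg zero_le_two (hnonneg x (le_of_lt hx)))
      (sub_nonpos.2 (hle x (le_of_lt hx)))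
  have := hanti self_mem_Ici (mem_Ici.2 ht) ht
  simp only [hc] at this
  linarith

/-- A derivative bound on `[a, b]` bounds the increment. -/
lemma sub_le_mul_sub_of_hasDerivAt_le {h h' : ℝ → ℝ} {a b C : ℝ}
    (hh : ∀ x, HasDerivAt h (h' x) x) (hab : a ≤ b)
    (hle : ∀ x, a ≤ x → x ≤ b → h' x ≤ C) : h b - h a ≤ C * (b - a) := by
  refine (convex_Icc a b).image_sub_le_mul_sub_of_deriv_le
    (fun x _ => (hh x).continuousAt.continuousWithinAt)
    (fun x _ => (hh x).differentiableAt.differentiableWithinAt) (fun x hx => ?_)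
    a (left_mem_Icc.2 hab) b (right_mem_Icc.2 hab) hab
  rw [(hh x).deriv]
  exact hle x (interior_subset hx).1 (interior_subset hx).2

/-- A slowly varying function that is convex on `[c, ∞)`, stationary at `c`, with slope
at least `1` at some point takes values in a single interval `[k + 1/2, k + 3/2)`
on some interval of length `L`. -/
lemma exists_Icc_mem_Ico_half {h h' h'' : ℝ → ℝ} {c L : ℝ} (hL : 0 < L)
    (hh : ∀ x, HasDerivAt h (h' x) x) (hh' : ∀ x, HasDerivAt h' (h'' x) x)
    (hpos : ∀ x, c ≤ x → 0 ≤ h'' x) (hle : ∀ x, c ≤ x → h'' x ≤ 1 / (8 * L ^ 2))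
    (hc : h' c = 0) (hgrow : ∃ b, c ≤ b ∧ 1 ≤ h' b) :
    ∃ (k : ℤ) (t : ℝ), ∀ x, t ≤ x → x ≤ t + L →
      (k : ℝ) + 1 / 2 ≤ h x ∧ h x < k + 3 / 2 := by
  have mono' : MonotoneOn h' (Ici c) := by
    refine monotoneOn_of_deriv_nonneg (convex_Ici c)
      (fun x _ => (hh' x).continuousAt.continuousWithinAt)
      (fun x _ => (hh' x).differentiableAt.differentiableWithinAt) fun x hx => ?_
    rw [(hh' x).deriv]
    exact hpos x (interior_subset hx)
  have hnonneg : ∀ x, c ≤ x → 0 ≤ h' x := fun x hx =>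
    hc ▸ mono' self_mem_Ici (mem_Ici.2 hx) hx
  have mono : MonotoneOn h (Ici c) := by
    refine monotoneOn_of_deriv_nonneg (convex_Ici c)
      (fun x _ => (hh x).continuousAt.continuousWithinAt)
      (fun x _ => (hh x).differentiableAt.differentiableWithinAt) fun x hx => ?_
    rw [(hh x).deriv]
    exact hnonneg x (interior_subset hx)
  obtain ⟨b, hcb, hb⟩ := hgrow
  have hb1 : h c + 1 ≤ h (b + 1) := by
    have h1 := sub_le_mul_sub_of_hasDerivAt_le (C := -1) (fun x => (hh x).neg)
      (le_add_of_nonneg_right zero_le_one : b ≤ b + 1) fun x hx _ =>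
        neg_le_neg (hb.trans (mono' hcb (mem_Ici.2 (hcb.trans hx)) hx))
    have h2 := mono self_mem_Ici (mem_Ici.2 hcb) hcb
    simp only [Pi.neg_apply] at h1
    linarith
  have hk1 := Int.le_ceil (h c - 1 / 2)
  have hk2 := Int.ceil_lt_add_one (h c - 1 / 2)
  set k := ⌈h c - 1 / 2⌉
  obtain ⟨t, ⟨hct, -⟩, ht⟩ := intermediate_value_Icc (by linarith : c ≤ b + 1)
    (fun x _ => (hh x).continuousAt.continuousWithinAt)
    (⟨by linarith, by linarith⟩ : (k : ℝ) + 1 / 2 ∈ Icc (h c) (h (b + 1)))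
  refine ⟨k, t, fun x htx hxt => ⟨ht ▸ mono hct (mem_Ici.2 (hct.trans htx)) htx, ?_⟩⟩
  have hslope : h' t ≤ 1 / (2 * L) := by
    refine le_of_sq_le_sq ?_ (by positivity)
    calc h' t ^ 2 ≤ 2 * (1 / (8 * L ^ 2)) * (h t - h c) :=
          sq_deriv_le_two_mul hh hh' hnonneg hle hc hct
      _ ≤ 2 * (1 / (8 * L ^ 2)) * 1 := by
          gcongr
          linarith
      _ = (1 / (2 * L)) ^ 2 := by
          field_simp
          norm_num
  have hslope' : ∀ y, t ≤ y → y ≤ x → h' y ≤ 5 / (8 * L) := fun y hty hyx => by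
    have h1 := sub_le_mul_sub_of_hasDerivAt_le hh' hty fun z hz _ => hle z (hct.trans hz)
    have h2 : 1 / (8 * L ^ 2) * (y - t) ≤ 1 / (8 * L ^ 2) * L := by
      gcongr
      linarith
    have h3 : 1 / (8 * L ^ 2) * L + 1 / (2 * L) = 5 / (8 * L) := by
      field_simp
      norm_num
    linarith
  have h1 := sub_le_mul_sub_of_hasDerivAt_le hh htx hslope'
  have h2 : 5 / (8 * L) * (x - t) ≤ 5 / (8 * L) * L := by
    gcongr
    linarith
  have h3 : 5 / (8 * L) * L = 5 / 8 := by field_simp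
  linarith

/-- if `f` is twice differentiable, with `f''` positive and antitone on
`[x₀, ∞)`, `f''(x) → 0` and `f'(x) → ∞`, then for every `M`, for every sufficiently
large natural number `n`, there is an integer `N` such that
`round(f(N + m)) = round(f(N)) + n·m` for all `m ≤ M`. -/
theorem lambda_existence (x₀ : ℝ) (f : ℝ → ℝ)
    (hf : Differentiable ℝ f) (hf' : Differentiable ℝ (deriv f))
    (h2pos : ∀ x : ℝ, x₀ ≤ x → 0 < deriv (deriv f) x)
    (h2anti : AntitoneOn (deriv (deriv f)) (Ici x₀))
    (h2lim : Tendsto (deriv (deriv f)) atTop (nhds 0))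
    (h1lim : Tendsto (deriv f) atTop atTop) :
    ∀ M : ℕ, ∃ n₀ : ℕ, ∀ n : ℕ, n₀ ≤ n → ∃ N : ℤ,
      ∀ m : ℕ, m ≤ M →
        round (f ((N : ℝ) + (m : ℝ))) = round (f (N : ℝ)) + (n : ℤ) * m := by
  intro M
  have hL : (0 : ℝ) < M + 1 := by positivity
  obtain ⟨X₁, hX₁⟩ := eventually_atTop.1
    (h2lim.eventually_le_const (by positivity : (0 : ℝ) < 1 / (8 * ((M : ℝ) + 1) ^ 2)))
  set X := max x₀ X₁
  refine ⟨⌈deriv f X⌉₊, fun n hn => ?_⟩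
  obtain ⟨Y, hXY, hY⟩ :=
    ((eventually_ge_atTop X).and (h1lim.eventually_ge_atTop ((n : ℝ) + 1))).exists
  obtain ⟨c, ⟨hXc, hcY⟩, hc⟩ := intermediate_value_Icc hXY hf'.continuous.continuousOn
    (⟨Nat.ceil_le.1 hn, by linarith⟩ : (n : ℝ) ∈ Icc (deriv f X) (deriv f Y))
  obtain ⟨k, t, hkt⟩ := exists_Icc_mem_Ico_half (h := fun x => f x - n * x)
    (h' := fun x => deriv f x - n) (h'' := deriv (deriv f)) (c := c) hL
    (fun x => ((hf x).hasDerivAt.sub ((hasDerivAt_id x).const_mul (n : ℝ))).congr_deriv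
      (by rw [mul_one]))
    (fun x => (hf' x).hasDerivAt.sub_const _)
    (fun x hx => (h2pos x ((le_max_left _ _).trans (hXc.trans hx))).le)
    (fun x hx => hX₁ x ((le_max_right _ _).trans (hXc.trans hx)))
    (sub_eq_zero.2 hc) ⟨Y, hcY, by linarith⟩
  have key : ∀ m : ℕ, m ≤ M →
      round (f ((⌈t⌉ : ℝ) + (m : ℝ))) = k + 1 + (n : ℤ) * (⌈t⌉ + m) := fun m hm => by
    have hm' : (m : ℝ) ≤ M := Nat.cast_le.2 hm
    obtain ⟨h1, h2⟩ := hkt ((⌈t⌉ : ℝ) + m)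
      ((Int.le_ceil t).trans (le_add_of_nonneg_right m.cast_nonneg))
      (by linarith [Int.ceil_lt_add_one t])
    rw [round_eq, Int.floor_eq_iff]
    push_cast
    constructor <;> linarith
  refine ⟨⌈t⌉, fun m hm => ?_⟩
  have h0 := key 0 M.zero_le
  simp only [Nat.cast_zero, add_zero] at h0
  rw [key m hm, h0]
  ring
end

section
/- Let x₀ be a real number and f : ℝ → ℝ a function that is continuous and strictly monotone increasing on [x₀, ∞), satisfies f(x) → ∞ as x → ∞, satisfies f(x) = 0 for all x < x₀, and is such that f(n) ≠ k + 1/2 for all integers n and k. Let y₀ be a real number and g : ℝ → ℝ a function such that for all y ≥ y₀ one has g(y) − 1/2 ≥ x₀ and f(g(y) − 1/2) = y − 1/2. Then there exists an integer m₀ such that for every integer m ≥ m₀, round(g(m)) is the least element of the set {n : ℤ | round(f(n)) ≥ m}. -/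
open Set Filter

/-- agreement of inverses. If `f` is continuous and strictly increasing
on `[x₀, ∞)`, tends to `∞`, vanishes below `x₀`, never takes a value in `ℤ + 1/2` at
an integer, and `g` satisfies `g(y) - 1/2 ≥ x₀` and `f(g(y) - 1/2) = y - 1/2` for
`y ≥ y₀`, then for all sufficiently large integers `m`, `round(g(m))` is the least
integer `n` with `round(f(n)) ≥ m`. -/
theorem agreement_of_inverses (x₀ : ℝ) (f : ℝ → ℝ)
    (hcont : ContinuousOn f (Ici x₀)) (hmono : StrictMonoOn f (Ici x₀))
    (htop : Tendsto f atTop atTop) (hzero : ∀ x : ℝ, x < x₀ → f x = 0)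
    (hhalf : ∀ n k : ℤ, f (n : ℝ) ≠ (k : ℝ) + 1 / 2)
    (y₀ : ℝ) (g : ℝ → ℝ)
    (hg : ∀ y : ℝ, y₀ ≤ y → x₀ ≤ g y - 1 / 2 ∧ f (g y - 1 / 2) = y - 1 / 2) :
    ∃ m₀ : ℤ, ∀ m : ℤ, m₀ ≤ m →
      IsLeast {n : ℤ | m ≤ round (f (n : ℝ))} (round (g (m : ℝ))) := by
  refine ⟨max 1 ⌈y₀⌉, fun m hm ↦ ?_⟩
  have hm1 : (1 : ℝ) ≤ m := by exact_mod_cast (le_max_left _ _).trans hm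
  obtain ⟨hx, hfx⟩ := hg m (Int.ceil_le.mp ((le_max_right _ _).trans hm))
  have hround : round (g m) = ⌊g m - 1 / 2⌋ + 1 := by
    rw [round_eq, ← Int.floor_add_one]
    congr 1
    ring
  rw [hround]
  constructor
  · have hlt := Int.lt_floor_add_one (g m - 1 / 2)
    have hf := hmono hx (hx.trans hlt.le) hlt
    rw [mem_ofPred_eq, round_eq, Int.le_floor]
    push_cast
    linarith
  · intro n hn
    rw [mem_ofPred_eq, round_eq, Int.le_floor] at hn
    have hne := hhalf n (m - 1)
    push_cast at hne
    have hf : f (g m - 1 / 2) < f n := by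
      rw [hfx]
      exact lt_of_le_of_ne (by linarith) fun h ↦ hne (by linarith)
    have hn₀ : x₀ ≤ n := by
      by_contra! h
      linarith [hzero n h]
    exact Int.add_one_le_of_lt (Int.floor_lt.mpr ((hmono.lt_iff_lt hx hn₀).mp hf))
end
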